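/- If every vertex of V has at most one child under E (a linear AI model), then every s-t cut C of the original DAG G satisfies T_G(C) = T(C ∩ V); consequently the minimum s-t cut value of G equals the minimum training delay over all splittings, i.e., for linear models the minimum s-t cut of the original DAG is exactly the optimal model splitting. -/

import Mathlib

open Finset

attribute [local instance] Classical.propDecidable

/-- Split-learning delay model: layers `V`, directed edges `E` (child consumes
parent's output), iteration count `N`, transmission rates `RD` (device→server)
and `RS` (server→device), per-layer device/server computation delays `xiD`/`xiS`,
parameter size `k`, and smashed-data size `a`. -/
structure SLModel (V : Type) where
  E : Finset (V × V)
  N : ℝ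
  RD : ℝ
  RS : ℝ
  xiD : V → ℝ
  xiS : V → ℝ
  k : V → ℝ
  a : V → ℝ

/-- The standing hypotheses: positive `N`, `RD`, `RS`, nonnegative per-layer
parameters, and `E` is acyclic (admits a topological ordering). -/
def SLModel.Valid {V : Type} (M : SLModel V) : Prop :=
  0 < M.N ∧ 0 < M.RD ∧ 0 < M.RS ∧ (∀ v, 0 ≤ M.xiD v) ∧ (∀ v, 0 ≤ M.xiS v) ∧
    (∀ v, 0 ≤ M.k v) ∧ (∀ v, 0 ≤ M.a v) ∧ ∃ f : V → ℕ, ∀ e ∈ M.E, f e.1 < f e.2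

/-- Boundary set `V_c` of a splitting `VD`: device layers with a child on the server. -/
noncomputable def SLModel.boundary {V : Type} (M : SLModel V) (VD : Finset V) : Finset V :=
  VD.filter (fun v => ∃ u, (v, u) ∈ M.E ∧ u ∉ VD)

/-- Training delay `T(V_D)` of a splitting. -/
noncomputable def SLModel.T {V : Type} [Fintype V] (M : SLModel V) (VD : Finset V) : ℝ :=
  M.N * ((∑ v ∈ VD, M.xiD v) + (∑ v ∈ M.boundary VD, M.a v / M.RD)
      + (∑ v ∈ Finset.univ \ VD, M.xiS v) + (∑ v ∈ M.boundary VD, M.a v / M.RS))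
    + (∑ v ∈ VD, M.k v / M.RD) + (∑ v ∈ VD, M.k v / M.RS)

/-- Weighted edges of the original DAG `G`: nodes are layers (`Sum.inl v`),
the virtual device/source `D = Sum.inr false`, and the virtual server/sink
`S = Sum.inr true`.  `wG M x y` is the weight of the edge `(x, y)` (0 if absent). -/
noncomputable def wG {V : Type} (M : SLModel V) : V ⊕ Bool → V ⊕ Bool → ℝ
  | Sum.inl u, Sum.inl v =>
      if (u, v) ∈ M.E then M.N * (M.a u / M.RD + M.a u / M.RS) else 0
  | Sum.inl v, Sum.inr b =>
      if b = true then M.N * M.xiD v + M.k v / M.RD + M.k v / M.RS else 0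
  | Sum.inr b, Sum.inl v =>
      if b = false then M.N * M.xiS v else 0
  | Sum.inr _, Sum.inr _ => 0

/-- An s-t cut of `G`: a vertex set containing `D` and not `S`. -/
def IsCutG {V : Type} (C : Finset (V ⊕ Bool)) : Prop :=
  Sum.inr false ∈ C ∧ Sum.inr true ∉ C

/-- Value `T_G(C)` of a cut: total weight of edges from inside `C` to outside `C`. -/
noncomputable def cutValG {V : Type} [Fintype V] (M : SLModel V) (C : Finset (V ⊕ Bool)) : ℝ :=
  ∑ x : V ⊕ Bool, ∑ y : V ⊕ Bool, if x ∈ C ∧ y ∉ C then wG M x y else 0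

/-- Number of children of `v` under `E`. -/
noncomputable def childCount {V : Type} (M : SLModel V) (v : V) : ℕ :=
  (M.E.filter (fun e => e.1 = v)).card

theorem SLModel.mem_boundary {V : Type} (M : SLModel V) (VD : Finset V) (v : V) :
    v ∈ M.boundary VD ↔ v ∈ VD ∧ ∃ u, (v, u) ∈ M.E ∧ u ∉ VD :=
  Finset.mem_filter

theorem SLModel.child_unique {V : Type} (M : SLModel V) {v u w : V}
    (h : childCount M v ≤ 1) (hu : (v, u) ∈ M.E) (hw : (v, w) ∈ M.E) : u = w := by
  have := Finset.card_le_one.mp h (v, u) (by simp [hu]) (v, w) (by simp [hw])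
  simpa using this

/-- With at most one child, a layer pays its propagation weight across a cut at most once. -/
theorem SLModel.sum_cut_children {V : Type} [Fintype V] (M : SLModel V) {v : V}
    (h : childCount M v ≤ 1) (VD : Finset V) (c : ℝ) :
    (∑ u : V, if v ∈ VD ∧ u ∉ VD then (if (v, u) ∈ M.E then c else 0) else 0)
      = if v ∈ M.boundary VD then c else 0 := by
  by_cases hv : v ∈ M.boundary VD
  · obtain ⟨hvD, u, hu, huD⟩ := (M.mem_boundary VD v).mp hv
    rw [if_pos hv, Finset.sum_eq_single u]
    · simp [hvD, hu, huD]
    · intro w _ hw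
      have : (v, w) ∉ M.E := fun hE => hw (M.child_unique h hE hu)
      simp [this]
    · simp
  · rw [if_neg hv]
    refine Finset.sum_eq_zero fun u _ => ?_
    split_ifs with h₁ h₂
    · exact absurd ((M.mem_boundary VD v).mpr ⟨h₁.1, u, h₂, h₁.2⟩) hv
    · rfl
    · rfl

theorem SLModel.T_eq_sum {V : Type} [Fintype V] (M : SLModel V) (VD : Finset V) :
    M.T VD = (∑ v : V, if v ∈ VD then M.N * M.xiD v + M.k v / M.RD + M.k v / M.RS else 0)
      + (∑ v : V, if v ∈ M.boundary VD then M.N * (M.a v / M.RD + M.a v / M.RS) else 0)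
      + ∑ v : V, if v ∉ VD then M.N * M.xiS v else 0 := by
  have hS : (∑ v : V, if v ∉ VD then M.N * M.xiS v else 0)
      = ∑ v ∈ Finset.univ \ VD, M.N * M.xiS v := by
    rw [← Finset.sum_filter]
    congr 1
    ext v
    simp
  rw [hS, Finset.sum_ite_mem, Finset.sum_ite_mem, Finset.univ_inter, Finset.univ_inter]
  simp only [SLModel.T, Finset.sum_add_distrib, ← Finset.mul_sum]
  ring

theorem cutValG_eq_T {V : Type} [Fintype V] (M : SLModel V)
    (hlin : ∀ v, childCount M v ≤ 1) {C : Finset (V ⊕ Bool)} (hC : IsCutG C) :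
    cutValG M C = M.T (Finset.univ.filter (fun v => (Sum.inl v : V ⊕ Bool) ∈ C)) := by
  have hprop := fun v => M.sum_cut_children (hlin v)
    (Finset.univ.filter (fun v => (Sum.inl v : V ⊕ Bool) ∈ C))
    (M.N * (M.a v / M.RD + M.a v / M.RS))
  rw [M.T_eq_sum]
  simp only [← hprop]
  obtain ⟨hD, hS⟩ := hC
  simp only [cutValG, Fintype.sum_sum_type, Fintype.sum_bool, wG, Finset.mem_filter,
    Finset.mem_univ, true_and, hD, hS, Finset.sum_add_distrib]
  simp
  ring

/-- **Linear models.** If every vertex has at most one child (a linear AI model),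
then every s-t cut `C` of the original DAG `G` satisfies `T_G(C) = T(C ∩ V)`;
consequently the minimum s-t cut value of `G` equals the minimum training delay
over all splittings. -/
theorem linear_model_exact {V : Type} [Fintype V] (M : SLModel V) (hM : M.Valid)
    (hlin : ∀ v, childCount M v ≤ 1) :
    (∀ C : Finset (V ⊕ Bool), IsCutG C →
        cutValG M C = M.T (Finset.univ.filter (fun v => (Sum.inl v : V ⊕ Bool) ∈ C)))
    ∧ sInf {x : ℝ | ∃ C : Finset (V ⊕ Bool), IsCutG C ∧ x = cutValG M C}
        = sInf {x : ℝ | ∃ VD : Finset V, x = M.T VD} := by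
  refine ⟨fun C hC => cutValG_eq_T M hlin hC, congrArg sInf (Set.ext fun x => ⟨?_, ?_⟩)⟩
  · rintro ⟨C, hC, rfl⟩
    exact ⟨_, cutValG_eq_T M hlin hC⟩
  · rintro ⟨VD, rfl⟩
    have hC : IsCutG (VD.disjSum {false}) := by simp [IsCutG]
    refine ⟨VD.disjSum {false}, hC, ?_⟩
    rw [cutValG_eq_T M hlin hC]
    congr 1
    ext v
    simp
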